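/- Let κ > 0 and α ∈ (0, 1/2) satisfy κ < λ^{1−2α}, and let M > 0. Then there exist a constant C' > 0 and a threshold L (depending only on Σ, κ, α, M) such that for every set S of finite nonempty admissible words, none containing another as a subword, whose minimal word length ℓ satisfies ℓ ≥ L and with |S| ≤ M·κ^ℓ, one has h(Σ) − h(Σ⟨S⟩) ≤ C'·(κ/λ^{1−2α})^{αℓ}·ℓ^{α−1}. -/

import Mathlib

open Filter MeasureTheory
open scoped BigOperators

namespace SFT

/-- A finite word `x_1 ⋯ x_m` is admissible if the `(x_{j+1}, x_j)` entry of `T`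
equals `1` for all `1 ≤ j < m`. -/
def Admissible {n : ℕ} (T : Matrix (Fin n) (Fin n) ℝ) (w : List (Fin n)) : Prop :=
  w.Chain' fun a b => T b a = 1

/-- The subshift of finite type `Σ` determined by `T`: bi-infinite sequences with
all transitions allowed. -/
def SFTspace {n : ℕ} (T : Matrix (Fin n) (Fin n) ℝ) : Set (ℤ → Fin n) :=
  {x | ∀ i : ℤ, T (x (i + 1)) (x i) = 1}

/-- The word `w` occurs in the bi-infinite sequence `x` starting at coordinate `a`. -/
def OccursAt {A : Type*} (w : List A) (x : ℤ → A) (a : ℤ) : Prop :=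
  ∀ (j : ℕ) (h : j < w.length), x (a + j) = w.get ⟨j, h⟩

/-- The word `w` occurs somewhere in the bi-infinite sequence `x`. -/
def Occurs {A : Type*} (w : List A) (x : ℤ → A) : Prop :=
  ∃ a : ℤ, OccursAt w x a

/-- `N_X(m)`: the number of words of length `m` occurring in elements of `X`. -/
noncomputable def wordCount {A : Type*} (X : Set (ℤ → A)) (m : ℕ) : ℕ :=
  {w : List A | w.length = m ∧ ∃ x ∈ X, Occurs w x}.ncard

/-- The entropy `h(X) = lim_{m→∞} (1/m) log N_X(m)` of a subshift (for subshifts the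
limit exists, hence coincides with the limsup used here). -/
noncomputable def entropy {A : Type*} (X : Set (ℤ → A)) : ℝ :=
  Filter.atTop.limsup fun m : ℕ => Real.log (wordCount X m) / m

/-- `Σ⟨S⟩`: the elements of `Σ` in which no word of `S` occurs. -/
def Avoid {n : ℕ} (T : Matrix (Fin n) (Fin n) ℝ) (S : Finset (List (Fin n))) :
    Set (ℤ → Fin n) :=
  {x ∈ SFTspace T | ∀ τ ∈ S, ¬ Occurs τ x}

/-- `p(t) = ∑_{τ ∈ S} t^{|τ|}`. -/
noncomputable def wordPoly {n : ℕ} (S : Finset (List (Fin n))) (t : ℝ) : ℝ :=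
  ∑ τ ∈ S, t ^ τ.length

/-- The cylinder set `[σ]` (inside `Σ`), with `σ` beginning at coordinate `0`.
It is empty when `σ` is not admissible. -/
def cylinder {n : ℕ} (T : Matrix (Fin n) (Fin n) ℝ) (σ : List (Fin n)) :
    Set (ℤ → Fin n) :=
  {x ∈ SFTspace T | OccursAt σ x 0}

/-- `N(σ, k)`: the number of words `η` of length `k` such that `ση` is admissible. -/
noncomputable def extCount {n : ℕ} (T : Matrix (Fin n) (Fin n) ℝ) (σ : List (Fin n))
    (k : ℕ) : ℕ :=
  {η : List (Fin n) | η.length = k ∧ Admissible T (σ ++ η)}.ncard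

/-- A word is `S`-free if no element of `S` occurs in it as a consecutive subword. -/
def SFree {A : Type*} (S : Finset (List A)) (w : List A) : Prop :=
  ∀ τ ∈ S, ¬ τ <:+: w

open Classical in
/-- `f_σ(α) = ∑_{τ ∈ S} ∑_j t^j`, the inner sum over integers `j ≥ 0` such that `τ`
occurs in `α` beginning within `σ` (placed at coordinate `0`) and ending `j` symbols
beyond the end of `σ`. -/
noncomputable def fword {n : ℕ} (S : Finset (List (Fin n))) (t : ℝ) (σ : List (Fin n))
    (x : ℤ → Fin n) : ℝ :=
  ∑ τ ∈ S, ∑ j ∈ Finset.range τ.length,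
    if τ.length ≤ σ.length + j ∧ OccursAt τ x ((σ.length : ℤ) + j - τ.length)
    then t ^ j else 0

/-- The weight `w(σ) = (1/μ([σ])) ∫_{[σ]} f_σ dμ`. -/
noncomputable def weight {n : ℕ} (T : Matrix (Fin n) (Fin n) ℝ)
    (μ : Measure (ℤ → Fin n)) (S : Finset (List (Fin n))) (t : ℝ)
    (σ : List (Fin n)) : ℝ :=
  (∫ x in cylinder T σ, fword S t σ x ∂μ) / (μ (cylinder T σ)).toReal

/-- `p_σ = ∑_{τ ∈ S} (μ([στ])/μ([σ])) t^{|τ|}`. -/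
noncomputable def pWord {n : ℕ} (T : Matrix (Fin n) (Fin n) ℝ)
    (μ : Measure (ℤ → Fin n)) (S : Finset (List (Fin n))) (t : ℝ)
    (σ : List (Fin n)) : ℝ :=
  ∑ τ ∈ S, (μ (cylinder T (σ ++ τ))).toReal / (μ (cylinder T σ)).toReal * t ^ τ.length

/-- `S_{σ,j}`: the subset of `[σ]` of elements containing some `τ ∈ S` that begins
within `σ` and ends `j` symbols after the end of `σ`. -/
def Ssub {n : ℕ} (T : Matrix (Fin n) (Fin n) ℝ) (S : Finset (List (Fin n)))
    (σ : List (Fin n)) (j : ℕ) : Set (ℤ → Fin n) :=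
  {x ∈ cylinder T σ | ∃ τ ∈ S, τ.length ≤ σ.length + j ∧ j < τ.length ∧
    OccursAt τ x ((σ.length : ℤ) + j - τ.length)}

/-- `η` is a good extension of an `S`-free word `σ`: `ση` is admissible and every
intermediate word between `σ` and `ση` (inclusive) has weight `< 1`. -/
def GoodExt {n : ℕ} (T : Matrix (Fin n) (Fin n) ℝ) (μ : Measure (ℤ → Fin n))
    (S : Finset (List (Fin n))) (t : ℝ) (σ η : List (Fin n)) : Prop :=
  Admissible T (σ ++ η) ∧ ∀ η', η' <+: η → weight T μ S t (σ ++ η') < 1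

/-- `G(σ, m)`: union of the cylinder sets `[ση]` over good `η` of length `m`. -/
def GSet {n : ℕ} (T : Matrix (Fin n) (Fin n) ℝ) (μ : Measure (ℤ → Fin n))
    (S : Finset (List (Fin n))) (t : ℝ) (σ : List (Fin n)) (m : ℕ) :
    Set (ℤ → Fin n) :=
  ⋃ η ∈ {η : List (Fin n) | η.length = m ∧ GoodExt T μ S t σ η}, cylinder T (σ ++ η)

/-- The alphabet of `Σ_k`: admissible words of length `k` in `Σ`. -/
def BlockAlphabet {n : ℕ} (T : Matrix (Fin n) (Fin n) ℝ) (k : ℕ) :=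
  {w : List (Fin n) // w.length = k ∧ Admissible T w}

/-- `Σ_k`: the SFT on admissible `k`-blocks, where `[x_1⋯x_k][y_1⋯y_k]` is an
allowed transition iff `x_k y_1` is admissible in `Σ`. -/
def SigmaBlock {n : ℕ} [NeZero n] (T : Matrix (Fin n) (Fin n) ℝ) (k : ℕ) :
    Set (ℤ → BlockAlphabet T k) :=
  {y | ∀ i : ℤ, T ((y (i + 1)).val.head!) ((y i).val.getLast!) = 1}

/-- The natural block-concatenation map `Σ_k → Σ`. -/
def blockConcat {n : ℕ} [NeZero n] (T : Matrix (Fin n) (Fin n) ℝ) (k : ℕ)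
    (y : ℤ → BlockAlphabet T k) : ℤ → Fin n :=
  fun m => (y (Int.fdiv m k)).val.getD (Int.fmod m k).toNat default


/-- The word of length `m` read off `x` starting at coordinate `a`. -/
def block {A : Type*} (x : ℤ → A) (a : ℤ) (m : ℕ) : List A :=
  List.ofFn fun i : Fin m => x (a + i)

@[simp] lemma block_length {A : Type*} (x : ℤ → A) (a : ℤ) (m : ℕ) :
    (block x a m).length = m := by
  simp [block]

lemma block_add {A : Type*} (x : ℤ → A) (a : ℤ) (p q : ℕ) :
    block x a (p + q) = block x a p ++ block x (a + p) q := by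
  simp [block, List.ofFn_add, add_assoc]

lemma block_infix {A : Type*} (x : ℤ → A) {a b : ℤ} {p q : ℕ} (hab : a ≤ b)
    (hb : b + q ≤ a + p) : block x b q <:+: block x a p := by
  obtain ⟨s, rfl⟩ : ∃ s : ℕ, b = a + s := ⟨(b - a).toNat, by omega⟩
  obtain ⟨r, rfl⟩ : ∃ r : ℕ, p = s + q + r := ⟨p - (s + q), by omega⟩
  rw [block_add, block_add]
  exact ⟨_, _, rfl⟩

lemma occursAt_iff_block {A : Type*} (w : List A) (x : ℤ → A) (a : ℤ) :
    OccursAt w x a ↔ block x a w.length = w := by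
  constructor
  · intro h
    refine List.ext_getElem (by simp) fun i h1 h2 => ?_
    simpa [block] using h i h2
  · intro h j hj
    have : (block x a w.length)[j]'(by simpa using hj) = w[j] := by simp only [h]
    simpa [block] using this

lemma exists_block_eq {A : Type*} [Nonempty A] (z : List A) (a : ℤ) :
    ∃ x : ℤ → A, block x a z.length = z := by
  refine ⟨fun i => z.getD (i - a).toNat (Classical.arbitrary A), ?_⟩
  refine List.ext_getElem (by simp) fun i h1 h2 => ?_
  simp [block]

/-- The words of length `m` in a language `P`. -/
noncomputable def wordsOf {A : Type*} [Finite A] (P : List A → Prop) (m : ℕ) :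
    Finset (List A) :=
  ((List.finite_length_eq A m).subset (fun _ h => h.1) :
    {w : List A | w.length = m ∧ P w}.Finite).toFinset

@[simp] lemma mem_wordsOf {A : Type*} [Finite A] {P : List A → Prop} {m : ℕ} {w : List A} :
    w ∈ wordsOf P m ↔ w.length = m ∧ P w := by
  simp [wordsOf]

/-- `w` extends to an element of `P` by at least `k` letters on each side. -/
def Extends {A : Type*} (P : List A → Prop) (k : ℕ) (w : List A) : Prop :=
  ∃ u₁ u₂ : List A, k ≤ u₁.length ∧ k ≤ u₂.length ∧ P (u₁ ++ w ++ u₂)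

lemma Extends.left {A : Type*} {P : List A → Prop} {k : ℕ} {w₁ w₂ : List A}
    (h : Extends P k (w₁ ++ w₂)) : Extends P k w₁ := by
  obtain ⟨u₁, u₂, h1, h2, h⟩ := h
  exact ⟨u₁, w₂ ++ u₂, h1, by simp; omega, by simpa using h⟩

lemma Extends.right {A : Type*} {P : List A → Prop} {k : ℕ} {w₁ w₂ : List A}
    (h : Extends P k (w₁ ++ w₂)) : Extends P k w₂ := by
  obtain ⟨u₁, u₂, h1, h2, h⟩ := h
  exact ⟨u₁ ++ w₁, u₂, by simp; omega, h2, by simpa using h⟩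

lemma card_wordsOf_extends_mul_le {A : Type*} [Finite A] (P : List A → Prop) (k m q : ℕ) :
    (wordsOf (Extends P k) (q * m)).card ≤ (wordsOf (Extends P k) m).card ^ q := by
  induction q with
  | zero =>
    rw [zero_mul, pow_zero, Finset.card_le_one]
    intro a ha b hb
    rw [mem_wordsOf, List.length_eq_zero_iff] at ha hb
    rw [ha.1, hb.1]
  | succ q ih =>
    rw [pow_succ']
    refine le_trans ?_ (Nat.mul_le_mul_left _ ih)
    rw [← Finset.card_product]
    refine Finset.card_le_card_of_injOn (fun u => (u.take m, u.drop m)) ?_ ?_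
    · intro u hu
      have hu := mem_wordsOf.1 (Finset.mem_coe.1 hu)
      have hsplit := List.take_append_drop m u
      have hext : Extends P k (u.take m ++ u.drop m) := by rw [hsplit]; exact hu.2
      have hlen : u.length = q * m + m := by rw [hu.1]; ring
      simp only [Finset.coe_product, Set.mem_prod, Finset.mem_coe, mem_wordsOf]
      refine ⟨⟨by simp [hlen], hext.left⟩, ⟨by simp [hlen], hext.right⟩⟩
    · intro u _ v _ huv
      simp only [Prod.mk.injEq] at huv
      rw [← List.take_append_drop m u, ← List.take_append_drop m v, huv.1, huv.2]

lemma card_wordsOf_le_extends {A : Type*} [Finite A] (P : List A → Prop) (k N : ℕ) :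
    (wordsOf P (k + (N + k))).card ≤
      (wordsOf (fun _ : List A => True) k).card ^ 2 * (wordsOf (Extends P k) N).card := by
  have : (wordsOf (fun _ : List A => True) k).card ^ 2 * (wordsOf (Extends P k) N).card =
      (wordsOf (fun _ : List A => True) k ×ˢ (wordsOf (Extends P k) N ×ˢ
        wordsOf (fun _ : List A => True) k)).card := by
    rw [Finset.card_product, Finset.card_product]; ring
  rw [this]
  refine Finset.card_le_card_of_injOn
    (fun u => (u.take k, (u.drop k).take N, (u.drop k).drop N)) ?_ ?_
  · intro u hu
    have hu := mem_wordsOf.1 (Finset.mem_coe.1 hu)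
    have h1 := List.take_append_drop k u
    have h2 := List.take_append_drop N (u.drop k)
    simp only [Finset.coe_product, Set.mem_prod, Finset.mem_coe, mem_wordsOf, and_true]
    refine ⟨by simp [hu.1], ⟨by simp [hu.1], u.take k, (u.drop k).drop N, ?_, ?_, ?_⟩,
      by simp [hu.1]; omega⟩
    · simp [hu.1]
    · simp [hu.1]; omega
    · rw [List.append_assoc, h2, h1]; exact hu.2
  · intro u _ v _ huv
    simp only [Prod.mk.injEq] at huv
    rw [← List.take_append_drop k u, ← List.take_append_drop k v,
      ← List.take_append_drop N (u.drop k), ← List.take_append_drop N (v.drop k),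
      huv.1, huv.2.1, huv.2.2]

/-- If the words of `P` grow at least like `β ^ m`, so do the words which extend by `k` letters
on each side. -/
lemma pow_le_card_wordsOf_extends {A : Type*} [Finite A] (P : List A → Prop) {c β : ℝ}
    (hc : 0 < c) (hβ : 0 < β) (hP : ∀ m, 1 ≤ m → c * β ^ m ≤ (wordsOf P m).card)
    (k : ℕ) {m : ℕ} (hm : 1 ≤ m) : β ^ m ≤ (wordsOf (Extends P k) m).card := by
  set E : ℝ := ((wordsOf (Extends P k) m).card : ℝ)
  by_contra! hlt
  set B : ℝ := ((wordsOf (fun _ : List A => True) k).card : ℝ) ^ 2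
  have key : ∀ q : ℕ, 1 ≤ q → c * β ^ (2 * k) ≤ B * (E / β ^ m) ^ q := by
    intro q hq
    have h1 := hP (k + (q * m + k)) (by nlinarith)
    have h2 : ((wordsOf P (k + (q * m + k))).card : ℝ) ≤ B * E ^ q := by
      have := (card_wordsOf_le_extends P k (q * m)).trans
        (Nat.mul_le_mul_left _ (card_wordsOf_extends_mul_le P k m q))
      simp only [B, E]
      exact_mod_cast this
    have h3 : β ^ (k + (q * m + k)) = β ^ (2 * k) * (β ^ m) ^ q := by
      rw [← pow_mul, ← pow_add]; congr 1; ring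
    rw [div_pow, ← mul_div_assoc, le_div_iff₀ (by positivity)]
    calc _ = c * β ^ (k + (q * m + k)) := by rw [h3]; ring
      _ ≤ _ := h1.trans h2
  have hlim : Tendsto (fun q : ℕ => B * (E / β ^ m) ^ q) atTop (nhds (B * 0)) :=
    (tendsto_pow_atTop_nhds_zero_of_lt_one (by positivity)
      ((div_lt_one (by positivity)).2 hlt)).const_mul B
  have := ge_of_tendsto hlim ((eventually_ge_atTop 1).mono key)
  have hpos : 0 < c * β ^ (2 * k) := by positivity
  linarith

lemma isClosed_setOf_block {A : Type*} [Finite A] [TopologicalSpace A] [DiscreteTopology A]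
    (P : List A → Prop) (a : ℤ) (m : ℕ) : IsClosed {x : ℤ → A | P (block x a m)} := by
  have hcont : Continuous fun (x : ℤ → A) (i : Fin m) => x (a + i) := by fun_prop
  exact (isClosed_discrete {y : Fin m → A | P (List.ofFn y)}).preimage hcont

/-- A word which extends arbitrarily far on both sides within a factor-closed language occurs in
a bi-infinite sequence all of whose blocks are in the language. -/
lemma exists_seq_of_extends {A : Type*} [Finite A] [Nonempty A] (P : List A → Prop)
    (hP : ∀ u v, u <:+: v → P v → P u) {w : List A} (hw : ∀ k, Extends P k w) :
    ∃ x : ℤ → A, (∀ a m, P (block x a m)) ∧ Occurs w x := by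
  let _ : TopologicalSpace A := ⊥
  have : DiscreteTopology A := ⟨rfl⟩
  let K : ℕ → Set (ℤ → A) := fun k =>
    {x | block x 0 w.length = w ∧ P (block x (-k) (k + w.length + k))}
  have hclosed : ∀ k, IsClosed (K k) := fun k =>
    (isClosed_setOf_block (fun u => u = w) 0 w.length).inter (isClosed_setOf_block P _ _)
  have hne : ∀ k, (K k).Nonempty := by
    intro k
    obtain ⟨u₁, u₂, h1, h2, h⟩ := hw k
    have h' : P ((u₁.drop (u₁.length - k)) ++ w ++ u₂.take k) := by
      refine hP _ _ ⟨u₁.take (u₁.length - k), u₂.drop k, ?_⟩ h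
      conv_rhs => rw [← List.take_append_drop (u₁.length - k) u₁, ← List.take_append_drop k u₂]
      simp only [List.append_assoc]
    set z := (u₁.drop (u₁.length - k)) ++ w ++ u₂.take k with hz
    have hl1 : (u₁.drop (u₁.length - k)).length = k := by simp; omega
    have hl2 : (u₂.take k).length = k := by simp; omega
    have hzl : z.length = k + w.length + k := by
      rw [hz, List.length_append, List.length_append, hl1, hl2]
    obtain ⟨x, hx⟩ := exists_block_eq z (-k)
    refine ⟨x, ?_, by rw [← hzl, hx]; exact h'⟩
    rw [hzl, block_add, block_add, hz] at hx
    have := (List.append_inj (List.append_inj hx (by simp [hl1])).1 (by simp; omega)).2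
    simpa using this
  have hanti : ∀ k, K (k + 1) ⊆ K k := by
    rintro k x ⟨h1, h2⟩
    exact ⟨h1, hP _ _ (block_infix x (by push_cast; omega) (by push_cast; omega)) h2⟩
  obtain ⟨x, hx⟩ := IsCompact.nonempty_iInter_of_sequence_nonempty_isCompact_isClosed K hanti hne
    (hclosed 0).isCompact hclosed
  rw [Set.mem_iInter] at hx
  refine ⟨x, fun a m => ?_, 0, (occursAt_iff_block _ _ _).2 (hx 0).1⟩
  exact hP _ _ (block_infix x (by omega) (by omega)) (hx (a.natAbs + m)).2

lemma Extends.mono {A : Type*} {P : List A → Prop} {k k' : ℕ} (hk : k ≤ k') {w : List A}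
    (h : Extends P k' w) : Extends P k w := by
  obtain ⟨u₁, u₂, h1, h2, h⟩ := h
  exact ⟨u₁, u₂, hk.trans h1, hk.trans h2, h⟩

lemma finite_setOf_occurs {A : Type*} [Finite A] (X : Set (ℤ → A)) (m : ℕ) :
    {w : List A | w.length = m ∧ ∃ x ∈ X, Occurs w x}.Finite :=
  (List.finite_length_eq A m).subset fun _ h => h.1

lemma pow_le_wordCount {A : Type*} [Finite A] [Nonempty A] (P : List A → Prop)
    (hP : ∀ u v, u <:+: v → P v → P u) {X : Set (ℤ → A)}
    (hX : ∀ x : ℤ → A, (∀ a m, P (block x a m)) → x ∈ X) {c β : ℝ}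
    (hc : 0 < c) (hβ : 0 < β) (hgrowth : ∀ m, 1 ≤ m → c * β ^ m ≤ (wordsOf P m).card)
    {m : ℕ} (hm : 1 ≤ m) : β ^ m ≤ wordCount X m := by
  have hex : ∀ w : List A, ∃ k, Extends P k w → ∀ k', Extends P k' w := by
    intro w
    by_cases h : ∀ k', Extends P k' w
    · exact ⟨0, fun _ => h⟩
    · push Not at h
      obtain ⟨k, hk⟩ := h
      exact ⟨k, fun h => absurd h hk⟩
  choose f hf using hex
  set k := (wordsOf (fun _ : List A => True) m).sup f
  refine (pow_le_card_wordsOf_extends P hc hβ hgrowth k hm).trans ?_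
  rw [wordCount, ← Set.ncard_coe_finset]
  refine Nat.cast_le.2 (Set.ncard_le_ncard ?_ (finite_setOf_occurs X m))
  intro w hw
  obtain ⟨hl, hw⟩ := mem_wordsOf.1 (Finset.mem_coe.1 hw)
  have hk : f w ≤ k := Finset.le_sup (f := f) (by simp [hl])
  obtain ⟨x, hx, hwx⟩ := exists_seq_of_extends P hP (hf w (hw.mono hk))
  exact ⟨hl, x, hX x hx, hwx⟩

lemma log_wordCount_div_nonneg {A : Type*} (X : Set (ℤ → A)) (m : ℕ) :
    0 ≤ Real.log (wordCount X m) / m :=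
  div_nonneg (Real.log_natCast_nonneg _) m.cast_nonneg

lemma log_wordCount_div_le {A : Type*} {X : Set (ℤ → A)} {C lam : ℝ} (hC : 1 ≤ C)
    (hlam : 1 ≤ lam) {m : ℕ} (hm : 1 ≤ m) (h : (wordCount X m : ℝ) ≤ C * lam ^ m) :
    Real.log (wordCount X m) / m ≤ Real.log C / m + Real.log lam := by
  have hm' : (0 : ℝ) < m := by exact_mod_cast hm
  rw [div_le_iff₀ hm', add_mul, div_mul_cancel₀ _ hm'.ne']
  have h1 : Real.log (C * lam ^ m) = Real.log C + Real.log lam * m := by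
    rw [Real.log_mul (by positivity) (by positivity), Real.log_pow]; ring
  rw [← h1]
  rcases Nat.eq_zero_or_pos (wordCount X m) with h0 | h0
  · rw [h0, Nat.cast_zero, Real.log_zero]
    exact Real.log_nonneg (one_le_mul_of_one_le_of_one_le hC (one_le_pow₀ hlam))
  · exact Real.log_le_log (by exact_mod_cast h0) h

lemma isBoundedUnder_log_wordCount {A : Type*} {X : Set (ℤ → A)} {C lam : ℝ} (hC : 1 ≤ C)
    (hlam : 1 ≤ lam) (h : ∀ m, 1 ≤ m → (wordCount X m : ℝ) ≤ C * lam ^ m) :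
    atTop.IsBoundedUnder (· ≤ ·) fun m : ℕ => Real.log (wordCount X m) / m := by
  refine isBoundedUnder_of_eventually_le (a := Real.log C + Real.log lam)
    ((eventually_ge_atTop 1).mono fun m hm => ?_)
  refine (log_wordCount_div_le hC hlam hm (h m hm)).trans (add_le_add_left ?_ _)
  exact div_le_self (Real.log_nonneg hC) (by exact_mod_cast hm)

lemma entropy_le_log {A : Type*} {X : Set (ℤ → A)} {C lam : ℝ} (hC : 1 ≤ C)
    (hlam : 1 ≤ lam) (h : ∀ m, 1 ≤ m → (wordCount X m : ℝ) ≤ C * lam ^ m) :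
    entropy X ≤ Real.log lam := by
  have hlim : Tendsto (fun m : ℕ => Real.log C / m + Real.log lam) atTop
      (nhds (Real.log lam)) := by
    simpa using (tendsto_const_div_atTop_nhds_zero_nat (Real.log C)).add_const (Real.log lam)
  rw [← hlim.limsup_eq]
  refine limsup_le_limsup ((eventually_ge_atTop 1).mono fun m hm =>
    log_wordCount_div_le hC hlam hm (h m hm)) ?_ hlim.isBoundedUnder_le
  exact (isBoundedUnder_of_eventually_ge (a := 0)
    (Eventually.of_forall (log_wordCount_div_nonneg X))).isCoboundedUnder_le

lemma log_le_entropy {A : Type*} {X : Set (ℤ → A)} {C lam β : ℝ} (hC : 1 ≤ C)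
    (hlam : 1 ≤ lam) (h : ∀ m, 1 ≤ m → (wordCount X m : ℝ) ≤ C * lam ^ m)
    (hβ : 0 < β) (hX : ∀ m, 1 ≤ m → β ^ m ≤ wordCount X m) :
    Real.log β ≤ entropy X := by
  refine le_limsup_of_frequently_le (Eventually.frequently
    ((eventually_ge_atTop 1).mono fun m hm => ?_)) (isBoundedUnder_log_wordCount hC hlam h)
  have hm' : (0 : ℝ) < m := by exact_mod_cast hm
  rw [le_div_iff₀ hm', mul_comm, ← Real.log_pow]
  exact Real.log_le_log (by positivity) (hX m hm)

lemma wordCount_mono {A : Type*} [Finite A] {X Y : Set (ℤ → A)} (h : X ⊆ Y) (m : ℕ) :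
    wordCount X m ≤ wordCount Y m :=
  Set.ncard_le_ncard (fun _ hw => ⟨hw.1, hw.2.imp fun _ hx => ⟨h hx.1, hx.2⟩⟩)
    (finite_setOf_occurs Y m)

/-- The words that are admissible and contain no word of `S`. -/
def FreeWord {n : ℕ} (T : Matrix (Fin n) (Fin n) ℝ) (S : Finset (List (Fin n)))
    (w : List (Fin n)) : Prop :=
  Admissible T w ∧ SFree S w

lemma FreeWord.infix {n : ℕ} {T : Matrix (Fin n) (Fin n) ℝ} {S : Finset (List (Fin n))}
    {u v : List (Fin n)} (huv : u <:+: v) (h : FreeWord T S v) : FreeWord T S u :=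
  ⟨List.IsChain.infix h.1 huv, fun τ hτ hu => h.2 τ hτ (hu.trans huv)⟩

lemma mem_Avoid_of_block {n : ℕ} {T : Matrix (Fin n) (Fin n) ℝ} {S : Finset (List (Fin n))}
    {x : ℤ → Fin n} (h : ∀ a m, FreeWord T S (block x a m)) : x ∈ Avoid T S := by
  refine ⟨fun i => ?_, fun τ hτ ⟨a, ha⟩ => ?_⟩
  · have h2 : Admissible T [x i, x (i + 1)] := by
      simpa [block, List.ofFn_succ] using (h i 2).1
    exact (List.isChain_cons_cons.1 h2).1
  · refine (h a τ.length).2 τ hτ ?_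
    rw [(occursAt_iff_block τ x a).1 ha]

lemma admissible_of_occurs {n : ℕ} {T : Matrix (Fin n) (Fin n) ℝ} {x : ℤ → Fin n}
    (hx : x ∈ SFTspace T) {w : List (Fin n)} (hw : Occurs w x) : Admissible T w := by
  obtain ⟨a, ha⟩ := hw
  refine List.isChain_iff_getElem.2 fun i hi => ?_
  have h1 := ha i (by omega)
  have h2 := ha (i + 1) hi
  have h3 := hx (a + i)
  simp only [List.get_eq_getElem] at h1 h2
  rw [← h1, ← h2]
  rw [add_assoc] at h3
  exact_mod_cast h3

/-- The entry of `v` at the first letter of a word. -/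
def headWeight {n : ℕ} (v : Fin n → ℝ) : List (Fin n) → ℝ
  | [] => 0
  | i :: _ => v i

/-- Total weight of the free words of length `m`. -/
noncomputable def freeWeight {n : ℕ} (T : Matrix (Fin n) (Fin n) ℝ)
    (S : Finset (List (Fin n))) (v : Fin n → ℝ) (m : ℕ) : ℝ :=
  ∑ w ∈ wordsOf (FreeWord T S) m, headWeight v w

/-- Admissible words whose tail is free have total weight `lam` times that of their tails. -/
lemma sum_headWeight_tail_free {n : ℕ} {T : Matrix (Fin n) (Fin n) ℝ} {lam : ℝ}
    (hT01 : ∀ i j, T i j = 0 ∨ T i j = 1) {v : Fin n → ℝ} (hTv : T.mulVec v = lam • v)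
    (S : Finset (List (Fin n))) {m : ℕ} (hm : 1 ≤ m) :
    ∑ u ∈ wordsOf (fun u => Admissible T u ∧ SFree S u.tail) (m + 1), headWeight v u =
      lam * freeWeight T S v m := by
  classical
  have hmaps : ∀ u ∈ wordsOf (fun u => Admissible T u ∧ SFree S u.tail) (m + 1),
      u.tail ∈ wordsOf (FreeWord T S) m := by
    intro u hu
    obtain ⟨hl, ha, hs⟩ := mem_wordsOf.1 hu
    exact mem_wordsOf.2 ⟨by simp [hl], List.IsChain.infix ha (List.tail_suffix u).isInfix, hs⟩
  rw [← Finset.sum_fiberwise_of_maps_to hmaps, freeWeight, Finset.mul_sum]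
  refine Finset.sum_congr rfl fun w hw => ?_
  obtain ⟨hl, ha, hs⟩ := mem_wordsOf.1 hw
  obtain ⟨i, w', rfl⟩ : ∃ i w', w = i :: w' := by
    cases w with
    | nil => simp at hl; omega
    | cons i w' => exact ⟨i, w', rfl⟩
  have hfiber : (wordsOf (fun u => Admissible T u ∧ SFree S u.tail) (m + 1)).filter
      (fun u => u.tail = i :: w') =
      (Finset.univ.filter fun j => T i j = 1).image (fun j => j :: i :: w') := by
    ext u
    simp only [Finset.mem_filter, mem_wordsOf, Finset.mem_image, Finset.mem_univ, true_and]
    constructor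
    · rintro ⟨⟨hl', ha', -⟩, ht⟩
      cases u with
      | nil => simp at ht
      | cons j u' =>
        rw [List.tail_cons] at ht
        subst ht
        exact ⟨j, (List.isChain_cons_cons.1 ha').1, rfl⟩
    · rintro ⟨j, hj, rfl⟩
      exact ⟨⟨by simpa using hl, List.isChain_cons_cons.2 ⟨hj, ha⟩, hs⟩, rfl⟩
  rw [hfiber, Finset.sum_image (fun a _ b _ h => (List.cons.inj h).1), Finset.sum_filter]
  have h1 := congrFun hTv i
  simp only [Matrix.mulVec, dotProduct, Pi.smul_apply, smul_eq_mul] at h1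
  rw [headWeight, ← h1]
  refine Finset.sum_congr rfl fun j _ => ?_
  rcases hT01 i j with h | h <;> simp [h, headWeight]

lemma freeWeight_le_mul_card {n : ℕ} (T : Matrix (Fin n) (Fin n) ℝ)
    (S : Finset (List (Fin n))) {v : Fin n → ℝ} {R : ℝ} (hR : 0 ≤ R) (hvR : ∀ i, v i ≤ R)
    (m : ℕ) : freeWeight T S v m ≤ R * (wordsOf (FreeWord T S) m).card := by
  refine (Finset.sum_le_card_nsmul _ _ R fun w _ => ?_).trans (by rw [nsmul_eq_mul, mul_comm])
  cases w with
  | nil => exact hR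
  | cons i _ => exact hvR i

lemma mul_card_le_freeWeight {n : ℕ} (T : Matrix (Fin n) (Fin n) ℝ)
    (S : Finset (List (Fin n))) {v : Fin n → ℝ} {r : ℝ} (hvr : ∀ i, r ≤ v i)
    {m : ℕ} (hm : 1 ≤ m) : r * (wordsOf (FreeWord T S) m).card ≤ freeWeight T S v m := by
  refine le_trans (by rw [nsmul_eq_mul, mul_comm]) (Finset.card_nsmul_le_sum _ _ r fun w hw => ?_)
  have hl := (mem_wordsOf.1 hw).1
  cases w with
  | nil => simp at hl; omega
  | cons i _ => exact hvr i

lemma freeWeight_nonneg {n : ℕ} (T : Matrix (Fin n) (Fin n) ℝ)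
    (S : Finset (List (Fin n))) {v : Fin n → ℝ} (hv : ∀ i, 0 ≤ v i) (m : ℕ) :
    0 ≤ freeWeight T S v m := by
  refine Finset.sum_nonneg fun w _ => ?_
  cases w with
  | nil => exact le_rfl
  | cons i _ => exact hv i

/-- Words which become non-free on adding their first letter start with a word of `S`. -/
lemma mul_freeWeight_le {n : ℕ} {T : Matrix (Fin n) (Fin n) ℝ} {lam : ℝ}
    (hT01 : ∀ i j, T i j = 0 ∨ T i j = 1) {v : Fin n → ℝ} (hTv : T.mulVec v = lam • v)
    {R : ℝ} (hR : 0 ≤ R) (hvR : ∀ i, v i ≤ R)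
    {S : Finset (List (Fin n))} {l : ℕ} (hl : 2 ≤ l) (hS : ∀ τ ∈ S, τ.length = l)
    {m : ℕ} (hm : 1 ≤ m) :
    lam * freeWeight T S v m ≤ freeWeight T S v (m + 1) +
      if l ≤ m + 1 then R * (S.card * (wordsOf (FreeWord T S) (m + 1 - (l - 1))).card)
      else 0 := by
  classical
  set Q := wordsOf (fun u => Admissible T u ∧ SFree S u.tail) (m + 1) with hQ
  have hgood : Q.filter (SFree S) = wordsOf (FreeWord T S) (m + 1) := by
    ext u
    simp only [hQ, Finset.mem_filter, mem_wordsOf, FreeWord]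
    constructor
    · rintro ⟨⟨h1, h2, -⟩, h4⟩
      exact ⟨h1, h2, h4⟩
    · rintro ⟨h1, h2, h4⟩
      exact ⟨⟨h1, h2, fun τ hτ h => h4 τ hτ (h.trans (List.tail_suffix u).isInfix)⟩, h4⟩
  have hprefix : ∀ u ∈ Q.filter (fun u => ¬ SFree S u), ∃ τ ∈ S, τ <+: u := by
    intro u hu
    obtain ⟨hu, hns⟩ := Finset.mem_filter.1 hu
    obtain ⟨hl, -, hs⟩ := mem_wordsOf.1 hu
    simp only [SFree, not_forall, not_not] at hns
    obtain ⟨τ, hτ, hτu⟩ := hns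
    refine ⟨τ, hτ, ?_⟩
    cases u with
    | nil => simp at hl
    | cons a u' =>
      rcases List.infix_cons_iff.1 hτu with h | h
      · exact h
      · exact absurd h (hs τ hτ)
  rw [← sum_headWeight_tail_free hT01 hTv S hm, ← hQ,
    ← Finset.sum_filter_add_sum_filter_not Q (SFree S), hgood, freeWeight]
  refine add_le_add_right ?_ _
  split_ifs with hlm
  · have hcard : (Q.filter (fun u => ¬ SFree S u)).card ≤
        S.card * (wordsOf (FreeWord T S) (m + 1 - (l - 1))).card := by
      rw [← Finset.card_product]
      refine Finset.card_le_card_of_injOn (fun u => (u.take l, u.drop (l - 1))) ?_ ?_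
      · intro u hu
        obtain ⟨τ, hτ, hτu⟩ := hprefix u hu
        obtain ⟨hu, -⟩ := Finset.mem_filter.1 (Finset.mem_coe.1 hu)
        obtain ⟨hl, ha, hs⟩ := mem_wordsOf.1 hu
        have h1 : u.take l = τ := by
          rw [← hS τ hτ]; exact (List.prefix_iff_eq_take.1 hτu).symm
        simp only [Finset.coe_product, Set.mem_prod, Finset.mem_coe, mem_wordsOf]
        refine ⟨h1 ▸ hτ, by simp [hl], ?_⟩
        have h2 : u.drop (l - 1) <:+ u.tail := by
          rw [← List.drop_one, show l - 1 = (l - 2) + 1 by omega, add_comm, ← List.drop_drop]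
          exact List.drop_suffix _ _
        exact FreeWord.infix h2.isInfix
          ⟨List.IsChain.infix ha (List.tail_suffix u).isInfix, hs⟩
      · intro u _ u' _ h
        simp only [Prod.mk.injEq] at h
        rw [← List.take_append_drop (l - 1) u, ← List.take_append_drop (l - 1) u', h.2]
        have h3 := congrArg (List.take (l - 1)) h.1
        rw [List.take_take, List.take_take, min_eq_left (Nat.sub_le l 1)] at h3
        rw [h3]
    calc _ ≤ (Q.filter (fun u => ¬ SFree S u)).card • R := by
          refine Finset.sum_le_card_nsmul _ _ R fun w _ => ?_
          cases w with
          | nil => exact hR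
          | cons i _ => exact hvR i
      _ ≤ _ := by
          rw [nsmul_eq_mul, mul_comm]
          exact mul_le_mul_of_nonneg_left (by exact_mod_cast hcard) hR
  · refine (Finset.sum_eq_zero fun u hu => ?_).le
    obtain ⟨τ, hτ, hτu⟩ := hprefix u hu
    have h1 := (mem_wordsOf.1 (Finset.mem_filter.1 hu).1).1
    have h2 := hτu.length_le
    rw [hS τ hτ] at h2
    omega

lemma mul_freeWeight_le_succ {n : ℕ} {T : Matrix (Fin n) (Fin n) ℝ} {lam : ℝ}
    (hT01 : ∀ i j, T i j = 0 ∨ T i j = 1) {v : Fin n → ℝ} (hTv : T.mulVec v = lam • v)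
    {r R : ℝ} (hr : 0 < r) (hR : 0 ≤ R) (hvr : ∀ i, r ≤ v i) (hvR : ∀ i, v i ≤ R)
    {S : Finset (List (Fin n))} {l : ℕ} (hl : 2 ≤ l) (hS : ∀ τ ∈ S, τ.length = l)
    {β : ℝ} (hβ : 0 < β) (hβlam : β ≤ lam)
    (hgap : R / r * S.card ≤ (lam - β) * β ^ (l - 2)) {m : ℕ} (hm : 1 ≤ m) :
    β * freeWeight T S v m ≤ freeWeight T S v (m + 1) := by
  have hnn := freeWeight_nonneg T S (v := v) (fun i => hr.le.trans (hvr i))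
  induction m using Nat.strong_induction_on with
  | _ m ih =>
  have hrec := mul_freeWeight_le hT01 hTv hR hvR hl hS hm
  split_ifs at hrec with hlm
  · set k := m + 1 - (l - 1) with hk
    have hpow : ∀ j, k + j ≤ m → β ^ j * freeWeight T S v k ≤ freeWeight T S v (k + j) := by
      intro j
      induction j with
      | zero => simp
      | succ j ihj =>
        intro hj
        calc β ^ (j + 1) * freeWeight T S v k = β * (β ^ j * freeWeight T S v k) := by ring
          _ ≤ β * freeWeight T S v (k + j) :=
            mul_le_mul_of_nonneg_left (ihj (by omega)) hβ.le
          _ ≤ _ := ih (k + j) (by omega) (by omega)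
    have h1 := hpow (l - 2) (by omega)
    rw [show k + (l - 2) = m by omega] at h1
    have h2 := mul_card_le_freeWeight T S hvr (show 1 ≤ k by omega)
    have h3 : R * (S.card * (wordsOf (FreeWord T S) k).card) ≤
        (lam - β) * freeWeight T S v m := by
      calc R * (S.card * ((wordsOf (FreeWord T S) k).card : ℝ))
          = R / r * S.card * (r * (wordsOf (FreeWord T S) k).card) := by field_simp
        _ ≤ R / r * S.card * freeWeight T S v k :=
          mul_le_mul_of_nonneg_left h2 (by positivity)
        _ ≤ (lam - β) * β ^ (l - 2) * freeWeight T S v k :=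
          mul_le_mul_of_nonneg_right hgap (hnn k)
        _ = (lam - β) * (β ^ (l - 2) * freeWeight T S v k) := by ring
        _ ≤ _ := mul_le_mul_of_nonneg_left h1 (by linarith)
    linarith
  · have := mul_le_mul_of_nonneg_right hβlam (hnn m)
    linarith

lemma freeWeight_one_pos {n : ℕ} [NeZero n] (T : Matrix (Fin n) (Fin n) ℝ)
    {v : Fin n → ℝ} (hv : ∀ i, 0 < v i) {S : Finset (List (Fin n))}
    (hS : ∀ τ ∈ S, 2 ≤ τ.length) : 0 < freeWeight T S v 1 := by
  refine Finset.sum_pos (fun w hw => ?_) ⟨[0], mem_wordsOf.2 ⟨rfl, List.isChain_singleton _, ?_⟩⟩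
  · have hl := (mem_wordsOf.1 hw).1
    cases w with
    | nil => simp at hl
    | cons i _ => exact hv i
  · intro τ hτ h
    have h1 := h.length_le
    have h2 := hS τ hτ
    simp at h1
    omega

lemma exists_wordCount_SFTspace_le {n : ℕ} {T : Matrix (Fin n) (Fin n) ℝ} {lam : ℝ}
    (hT01 : ∀ i j, T i j = 0 ∨ T i j = 1) (hlam : 0 < lam) {v : Fin n → ℝ}
    (hTv : T.mulVec v = lam • v) {r : ℝ} (hr : 0 < r) (hvr : ∀ i, r ≤ v i) :
    ∃ C : ℝ, 1 ≤ C ∧ ∀ m, 1 ≤ m → (wordCount (SFTspace T) m : ℝ) ≤ C * lam ^ m := by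
  set D := freeWeight T ∅ v 1 / (r * lam)
  have hgrow : ∀ m, freeWeight T ∅ v (m + 1) ≤ freeWeight T ∅ v 1 * lam ^ m := by
    intro m
    induction m with
    | zero => simp
    | succ m ih =>
      have h := sum_headWeight_tail_free hT01 hTv ∅ (m := m + 1) (by omega)
      have h' : (fun u => Admissible T u ∧ SFree ∅ u.tail) = FreeWord T ∅ := by
        funext u; simp [FreeWord, SFree]
      rw [h'] at h
      rw [freeWeight, h, pow_succ]
      nlinarith
  refine ⟨max 1 D, le_max_left _ _, fun m hm => ?_⟩
  have h1 : wordCount (SFTspace T) m ≤ (wordsOf (FreeWord T ∅) m).card := by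
    rw [wordCount, ← Set.ncard_coe_finset]
    refine Set.ncard_le_ncard ?_ (Finset.finite_toSet _)
    rintro w ⟨hl, x, hx, hw⟩
    exact mem_wordsOf.2 ⟨hl, admissible_of_occurs hx hw, by simp [SFree]⟩
  have h2 := mul_card_le_freeWeight T ∅ hvr hm
  obtain ⟨k, rfl⟩ : ∃ k, m = k + 1 := ⟨m - 1, by omega⟩
  have h3 := h2.trans (hgrow k)
  have h4 : ((wordsOf (FreeWord T ∅) (k + 1)).card : ℝ) ≤ D * lam ^ (k + 1) := by
    rw [show D * lam ^ (k + 1) = freeWeight T ∅ v 1 * lam ^ k / r by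
      simp only [D]; field_simp; ring, le_div_iff₀ hr]
    linarith
  calc (wordCount (SFTspace T) (k + 1) : ℝ) ≤ D * lam ^ (k + 1) :=
        le_trans (by exact_mod_cast h1) h4
    _ ≤ _ := mul_le_mul_of_nonneg_right (le_max_right _ _) (by positivity)

/-- Forbidding words of equal length `l` costs at most `log (lam / β)` in entropy as soon as the
number of words is at most a constant times `(lam - β) * β ^ (l - 2)`. -/
lemma entropy_sub_le_log_div {n : ℕ} [NeZero n] {T : Matrix (Fin n) (Fin n) ℝ} {lam : ℝ}
    (hT01 : ∀ i j, T i j = 0 ∨ T i j = 1) (hlam : 1 ≤ lam) {v : Fin n → ℝ}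
    (hTv : T.mulVec v = lam • v)
    {r R : ℝ} (hr : 0 < r) (hvr : ∀ i, r ≤ v i) (hvR : ∀ i, v i ≤ R)
    {S : Finset (List (Fin n))} {l : ℕ} (hl : 2 ≤ l) (hS : ∀ τ ∈ S, τ.length = l)
    {β : ℝ} (hβ : 0 < β) (hβlam : β ≤ lam)
    (hgap : R / r * S.card ≤ (lam - β) * β ^ (l - 2)) :
    entropy (SFTspace T) - entropy (Avoid T S) ≤ Real.log lam - Real.log β := by
  have hR : 0 < R := hr.trans_le ((hvr 0).trans (hvR 0))
  obtain ⟨C, hC, hcount⟩ := exists_wordCount_SFTspace_le hT01 (by linarith) hTv hr hvr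
  have hpos := freeWeight_one_pos T (fun i => hr.trans_le (hvr i)) (S := S)
    (fun τ hτ => (hS τ hτ).symm ▸ hl)
  have hgrow : ∀ m, β ^ m * freeWeight T S v 1 ≤ freeWeight T S v (m + 1) := by
    intro m
    induction m with
    | zero => simp
    | succ m ih =>
      have := mul_freeWeight_le_succ hT01 hTv hr hR.le hvr hvR hl hS hβ hβlam hgap
        (m := m + 1) (by omega)
      refine le_trans ?_ this
      rw [pow_succ', mul_assoc]
      exact mul_le_mul_of_nonneg_left ih hβ.le
  have hcard : ∀ m, 1 ≤ m →
      freeWeight T S v 1 / (β * R) * β ^ m ≤ (wordsOf (FreeWord T S) m).card := by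
    intro m hm
    obtain ⟨k, rfl⟩ : ∃ k, m = k + 1 := ⟨m - 1, by omega⟩
    have h := (hgrow k).trans (freeWeight_le_mul_card T S hR.le hvR (k + 1))
    rw [show freeWeight T S v 1 / (β * R) * β ^ (k + 1) = β ^ k * freeWeight T S v 1 / R by
      field_simp; ring, div_le_iff₀ hR]
    linarith
  have hlow : Real.log β ≤ entropy (Avoid T S) := by
    refine log_le_entropy hC hlam (fun m hm => le_trans ?_ (hcount m hm)) hβ fun m hm =>
      pow_le_wordCount (FreeWord T S) (fun _ _ => FreeWord.infix)
        (fun _ => mem_Avoid_of_block) (div_pos hpos (mul_pos hβ hR)) hβ hcard hm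
    exact_mod_cast wordCount_mono (X := Avoid T S) (fun _ hx => hx.1) m
  linarith [entropy_le_log hC hlam hcount]

lemma entropy_mono {A : Type*} [Finite A] {X Y : Set (ℤ → A)} {C lam : ℝ} (hC : 1 ≤ C)
    (hlam : 1 ≤ lam) (hY : ∀ m, 1 ≤ m → (wordCount Y m : ℝ) ≤ C * lam ^ m) (h : X ⊆ Y) :
    entropy X ≤ entropy Y := by
  refine limsup_le_limsup (Eventually.of_forall fun m => ?_)
    (isBoundedUnder_of_eventually_ge (a := 0)
      (Eventually.of_forall (log_wordCount_div_nonneg X))).isCoboundedUnder_le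
    (isBoundedUnder_log_wordCount hC hlam hY)
  refine div_le_div_of_nonneg_right ?_ m.cast_nonneg
  rcases Nat.eq_zero_or_pos (wordCount X m) with h0 | h0
  · rw [h0, Nat.cast_zero, Real.log_zero]
    exact Real.log_natCast_nonneg _
  · exact Real.log_le_log (by exact_mod_cast h0) (by exact_mod_cast wordCount_mono h m)

lemma Avoid_image_take_subset {n : ℕ} (T : Matrix (Fin n) (Fin n) ℝ)
    (S : Finset (List (Fin n))) (l : ℕ) : Avoid T (S.image (List.take l)) ⊆ Avoid T S := by
  rintro x ⟨hx, hS⟩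
  refine ⟨hx, fun τ hτ ⟨a, ha⟩ => hS _ (Finset.mem_image_of_mem _ hτ) ⟨a, fun j hj => ?_⟩⟩
  have hj' : j < τ.length := by simp at hj; omega
  simpa using ha j hj'

/-- **Growing sets of words.** Let `κ > 0` and `α ∈ (0, 1/2)` with `κ < λ^{1-2α}`,
and let `M > 0`. Then there are `C' > 0` and a threshold `L` such that for every
set `S` (pairwise not containing one another) with minimal word length `ℓ ≥ L` and
`|S| ≤ M·κ^ℓ`, one has `h(Σ) - h(Σ⟨S⟩) ≤ C'·(κ/λ^{1-2α})^{αℓ}·ℓ^{α-1}`. -/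
theorem entropy_bound_growing_card
    {n : ℕ} (T : Matrix (Fin n) (Fin n) ℝ) (lam : ℝ)
    (hT01 : ∀ i j, T i j = 0 ∨ T i j = 1)
    (hirr : ∀ i j : Fin n, ∃ m : ℕ, 0 < m ∧ 0 < (T ^ m) i j)
    (hlam : 1 < lam)
    (hPerron : ∃ v : Fin n → ℝ, (∀ i, 0 < v i) ∧ T.mulVec v = lam • v)
    (κ α M : ℝ) (hκ : 0 < κ) (hα0 : 0 < α) (hα : α < 1 / 2)
    (hκlam : κ < lam ^ (1 - 2 * α)) (hM : 0 < M) :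
    ∃ C' : ℝ, 0 < C' ∧ ∃ L : ℕ,
      ∀ S : Finset (List (Fin n)),
        (∀ τ ∈ S, τ ≠ []) → (∀ τ ∈ S, Admissible T τ) →
        (∀ τ ∈ S, ∀ τ' ∈ S, τ ≠ τ' → ¬ τ <:+: τ') →
        ∀ l : ℕ, L ≤ l →
        (∀ τ ∈ S, l ≤ τ.length) → (∃ τ ∈ S, τ.length = l) →
        ((S.card : ℝ) ≤ M * κ ^ l) →
        entropy (SFTspace T) - entropy (Avoid T S) ≤
          C' * (κ / lam ^ (1 - 2 * α)) ^ (α * l) * (l : ℝ) ^ (α - 1) := by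
  obtain ⟨v, hv, hTv⟩ := hPerron
  rcases Nat.eq_zero_or_pos n with rfl | hn
  · refine ⟨1, one_pos, 0, fun S hne _ _ l _ _ hex _ => ?_⟩
    obtain ⟨τ, hτ, -⟩ := hex
    cases τ with
    | nil => exact absurd rfl (hne _ hτ)
    | cons a _ => exact a.elim0
  have : NeZero n := ⟨hn.ne'⟩
  obtain ⟨i₀, hi₀⟩ := Finite.exists_min v
  obtain ⟨i₁, hi₁⟩ := Finite.exists_max v
  have hlam0 : 0 < lam := by linarith
  have hr : 0 < v i₀ := hv i₀
  have hR : 0 < v i₁ := hv i₁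
  obtain ⟨K, hKdef⟩ : ∃ K, K = 2 * (v i₁ / v i₀) * M * lam := ⟨_, rfl⟩
  have hK : 0 < K := by rw [hKdef]; positivity
  have hκlam' : κ < lam :=
    hκlam.trans_le (Real.rpow_le_self_of_one_le hlam.le (by linarith))
  have hθ0 : 0 < κ / lam := by positivity
  have hθ1 : κ / lam < 1 := (div_lt_one hlam0).2 hκlam'
  have hρ1 : lam ^ (-(2 * α)) < 1 := Real.rpow_lt_one_of_one_lt_of_neg hlam (by linarith)
  have hlim := (tendsto_self_mul_const_pow_of_lt_one hθ0.le hθ1).const_mul K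
  rw [mul_zero] at hlim
  obtain ⟨L, hL⟩ := eventually_atTop.1 ((hlim.eventually_le_const (show (0 : ℝ) < 1 / 2 by
    norm_num)).and ((tendsto_self_mul_const_pow_of_lt_one (Real.rpow_nonneg hlam0.le _)
      hρ1).eventually_le_const one_pos))
  refine ⟨2 * K, by positivity, max L 2, fun S _ _ _ l hl hlen _ hcard => ?_⟩
  have hl2 : 2 ≤ l := (le_max_right _ _).trans hl
  obtain ⟨hε, hρ⟩ := hL l ((le_max_left _ _).trans hl)
  have hl0 : (0 : ℝ) < l := by exact_mod_cast (by omega : 0 < l)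
  set ε := K * (κ / lam) ^ l with hεdef
  have hε0 : 0 < ε := by positivity
  have hlε : l * ε ≤ 1 / 2 := by rw [hεdef]; linarith
  have hl2' : (2 : ℝ) ≤ l := by exact_mod_cast hl2
  have hε1 : ε ≤ 1 / 2 := by nlinarith
  have hS' : ∀ τ ∈ S.image (List.take l), τ.length = l := by
    intro τ hτ
    obtain ⟨τ', hτ', rfl⟩ := Finset.mem_image.1 hτ
    rw [List.length_take, min_eq_left (hlen τ' hτ')]
  have hgap : v i₁ / v i₀ * (S.image (List.take l)).card ≤
      (lam - lam * (1 - ε)) * (lam * (1 - ε)) ^ (l - 2) := by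
    have h1 : ((S.image (List.take l)).card : ℝ) ≤ M * κ ^ l :=
      le_trans (by exact_mod_cast Finset.card_image_le) hcard
    have h2 : 1 / 2 ≤ (1 - ε) ^ (l - 2) := by
      have hb := one_add_mul_le_pow (show -2 ≤ -ε by linarith) (l - 2)
      have hc : ((l - 2 : ℕ) : ℝ) ≤ l := by exact_mod_cast Nat.sub_le l 2
      rw [← sub_eq_add_neg 1 ε] at hb
      nlinarith
    have h3 : lam ^ l = lam ^ (l - 2) * lam ^ 2 := by rw [← pow_add]; congr 1; omega
    calc v i₁ / v i₀ * ((S.image (List.take l)).card : ℝ)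
        ≤ v i₁ / v i₀ * (M * κ ^ l) := mul_le_mul_of_nonneg_left h1 (by positivity)
      _ = lam * ε * lam ^ (l - 2) * (1 / 2) := by
          rw [hεdef, hKdef, div_pow, h3]; field_simp
      _ ≤ lam * ε * lam ^ (l - 2) * (1 - ε) ^ (l - 2) :=
          mul_le_mul_of_nonneg_left h2 (by positivity)
      _ = _ := by rw [mul_pow]; ring
  have hmain := entropy_sub_le_log_div hT01 hlam.le hTv hr hi₀ hi₁ hl2 hS'
    (mul_pos hlam0 (by linarith)) (by nlinarith) hgap
  have hlog : Real.log lam - Real.log (lam * (1 - ε)) ≤ 2 * ε := by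
    rw [Real.log_mul hlam0.ne' (by linarith)]
    have h1 := Real.one_sub_inv_le_log_of_pos (show 0 < 1 - ε by linarith)
    have h2 : (1 - ε)⁻¹ ≤ 1 + 2 * ε := by
      rw [inv_le_iff_one_le_mul₀ (by linarith)]
      nlinarith
    linarith
  have hsub : entropy (Avoid T (S.image (List.take l))) ≤ entropy (Avoid T S) := by
    obtain ⟨C, hC, hcount⟩ := exists_wordCount_SFTspace_le hT01 hlam0 hTv hr hi₀
    exact entropy_mono hC hlam.le (fun m hm => le_trans
      (by exact_mod_cast wordCount_mono (X := Avoid T S) (fun _ hx => hx.1) m) (hcount m hm))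
      (Avoid_image_take_subset T S l)
  have hdecay : (κ / lam) ^ l ≤
      (κ / lam ^ (1 - 2 * α)) ^ (α * l) * (l : ℝ) ^ (α - 1) := by
    have hq0 : 0 < κ / lam ^ (1 - 2 * α) := by positivity
    have hq1 : κ / lam ^ (1 - 2 * α) < 1 := (div_lt_one (by positivity)).2 hκlam
    have h1 : κ / lam = κ / lam ^ (1 - 2 * α) * lam ^ (-(2 * α)) := by
      rw [div_mul_eq_mul_div, div_eq_div_iff hlam0.ne' (by positivity), mul_assoc,
        ← Real.rpow_add_one hlam0.ne']
      ring_nf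
    rw [h1, mul_pow]
    refine mul_le_mul ?_ ?_ (by positivity) (by positivity)
    · rw [← Real.rpow_natCast]
      exact Real.rpow_le_rpow_of_exponent_ge hq0 hq1.le (by nlinarith)
    · calc (lam ^ (-(2 * α))) ^ l ≤ (l : ℝ) ^ (-1 : ℝ) := by
            rw [Real.rpow_neg_one, ← one_div, le_div_iff₀ hl0]
            linarith
        _ ≤ _ := Real.rpow_le_rpow_of_exponent_le (by exact_mod_cast (by omega : 1 ≤ l))
            (by linarith)
  calc entropy (SFTspace T) - entropy (Avoid T S) ≤ 2 * ε := by linarith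
    _ = 2 * K * (κ / lam) ^ l := by rw [hεdef]; ring
    _ ≤ 2 * K * ((κ / lam ^ (1 - 2 * α)) ^ (α * l) * (l : ℝ) ^ (α - 1)) :=
      mul_le_mul_of_nonneg_left hdecay (by positivity)
    _ = _ := by ring

end SFT
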